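/- A strongly-connected marked free-choice net having a home cluster is live, safe, and lucent. -/

import Mathlib

open scoped Classical

/-- A Petri net over places `P` and transitions `T`, given by preset and postset
of each transition (this encodes the flow relation `F`). -/
structure PetriNet (P T : Type) where
  pre : T → Finset P
  post : T → Finset P

namespace PetriNet

variable {P T : Type} [DecidableEq P] (N : PetriNet P T)

/-- A transition is enabled if each input place holds at least one token. -/
def enabled (M : P → ℕ) (t : T) : Prop := ∀ p ∈ N.pre t, 1 ≤ M p

/-- Firing a transition. -/
def fire (M : P → ℕ) (t : T) : P → ℕ :=
  fun p => M p - (if p ∈ N.pre t then 1 else 0) + (if p ∈ N.post t then 1 else 0)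

/-- `Fires M σ M'` : the firing sequence σ is enabled in M and leads to M'. -/
inductive Fires : (P → ℕ) → List T → (P → ℕ) → Prop
  | nil (M : P → ℕ) : Fires M [] M
  | cons {M : P → ℕ} {t : T} {σ : List T} {M'' : P → ℕ} :
      N.enabled M t → Fires (N.fire M t) σ M'' → Fires M (t :: σ) M''

/-- Reachability of markings. -/
def Reach (M M' : P → ℕ) : Prop := ∃ σ : List T, N.Fires M σ M'

/-- The set of transitions enabled in a marking. -/
def en (M : P → ℕ) : Set T := {t | N.enabled M t}

/-- Lucency: reachable markings are determined by their sets of enabled transitions. -/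
def Lucent (M : P → ℕ) : Prop :=
  ∀ M1 M2 : P → ℕ, N.Reach M M1 → N.Reach M M2 → N.en M1 = N.en M2 → M1 = M2

/-- Free-choice: presets of any two transitions are equal or disjoint. -/
def FreeChoice : Prop :=
  ∀ t1 t2 : T, N.pre t1 = N.pre t2 ∨ N.pre t1 ∩ N.pre t2 = ∅

/-- Proper: every transition has a nonempty preset and postset. -/
def Proper : Prop := ∀ t : T, (N.pre t).Nonempty ∧ (N.post t).Nonempty

/-- The directed edge (flow) relation on nodes `P ⊕ T`. -/
def edge : (P ⊕ T) → (P ⊕ T) → Prop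
  | Sum.inl p, Sum.inr t => p ∈ N.pre t
  | Sum.inr t, Sum.inl p => p ∈ N.post t
  | _, _ => False

/-- `InCluster x y` : y is in the cluster of x (smallest set containing x closed
under adding output transitions of places and input places of transitions). -/
inductive InCluster : (P ⊕ T) → (P ⊕ T) → Prop
  | refl (x : P ⊕ T) : InCluster x x
  | toTrans {x : P ⊕ T} {p : P} {t : T} :
      InCluster x (Sum.inl p) → p ∈ N.pre t → InCluster x (Sum.inr t)
  | toPlace {x : P ⊕ T} {t : T} {p : P} :
      InCluster x (Sum.inr t) → p ∈ N.pre t → InCluster x (Sum.inl p)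

/-- The cluster of a node. -/
def cluster (x : P ⊕ T) : Set (P ⊕ T) := {y | N.InCluster x y}

/-- A set of nodes is a cluster if it is the cluster of some node. -/
def IsCluster (C : Set (P ⊕ T)) : Prop := ∃ x : P ⊕ T, C = N.cluster x

/-- `Mrk(C)` : one token on each place of `C`, no tokens elsewhere. -/
noncomputable def clusterMrk (C : Set (P ⊕ T)) : P → ℕ :=
  fun p => if Sum.inl p ∈ C then 1 else 0

/-- A home marking is reachable from every reachable marking. -/
def IsHomeMarking (M MH : P → ℕ) : Prop := ∀ M', N.Reach M M' → N.Reach M' MH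

/-- A home cluster is a cluster whose marking `Mrk(C)` is a home marking. -/
def HomeCluster (M : P → ℕ) (C : Set (P ⊕ T)) : Prop :=
  N.IsCluster C ∧ N.IsHomeMarking M (clusterMrk C)

/-- A conflict-pair for `(N,M)`. -/
def ConflictPair (M M1 M2 : P → ℕ) : Prop :=
  N.Reach M M1 ∧ N.Reach M M2 ∧
  (∃ t, N.enabled M1 t) ∧ (∃ t, N.enabled M2 t) ∧
  (∀ t, ¬ (N.enabled M1 t ∧ N.enabled M2 t)) ∧
  (∀ t, N.enabled M1 t → ∃ p ∈ N.pre t, 1 ≤ M2 p) ∧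
  (∀ t, N.enabled M2 t → ∃ p ∈ N.pre t, 1 ≤ M1 p)

/-- A disentangled path `⟨p_1,t_1,p_2,…,t_{n-1},p_n⟩`, given by its lists of
places and transitions: consecutive nodes are connected by the flow relation and
all places lie in pairwise distinct clusters. -/
def IsDisPath (ps : List P) (ts : List T) : Prop :=
  ps.length = ts.length + 1 ∧
  (∀ (i : ℕ) (t : T) (p p' : P), ts[i]? = some t → ps[i]? = some p →
      ps[i + 1]? = some p' → p ∈ N.pre t ∧ p' ∈ N.post t) ∧
  ps.Pairwise (fun a b => N.cluster (Sum.inl a) ≠ N.cluster (Sum.inl b))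

/-- `Exp M σ σ'` : σ' is obtained from σ by repeatedly expediting transitions
(moving the transition at position j to an earlier position i, provided the
prefix of length i followed by that transition is enabled from M and no
transition at positions i..j-1 shares its cluster). -/
inductive Exp (M : P → ℕ) (σ : List T) : List T → Prop
  | refl : Exp M σ σ
  | step {σ' : List T} {i j : ℕ} (h : Exp M σ σ') (hij : i < j) (hj : j < σ'.length)
      (ha : ∃ Mx, N.Fires M (σ'.take i ++ [σ'.get ⟨j, hj⟩]) Mx)
      (hb : ∀ (k : ℕ) (hk : k < σ'.length), i ≤ k → k < j →
        N.cluster (Sum.inr (σ'.get ⟨k, hk⟩)) ≠ N.cluster (Sum.inr (σ'.get ⟨j, hj⟩))) :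
      Exp M σ ((σ'.eraseIdx j).insertIdx i (σ'.get ⟨j, hj⟩))

/-- Liveness: from every reachable marking, every transition can be enabled again. -/
def Live (M : P → ℕ) : Prop :=
  ∀ M', N.Reach M M' → ∀ t : T, ∃ M'', N.Reach M' M'' ∧ N.enabled M'' t

/-- Boundedness. -/
def Bounded (M : P → ℕ) : Prop :=
  ∃ k, ∀ M', N.Reach M M' → ∀ p, M' p ≤ k

/-- Safety (1-boundedness). -/
def Safe (M : P → ℕ) : Prop := ∀ M', N.Reach M M' → ∀ p, M' p ≤ 1

end PetriNet

namespace HomeProof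

open PetriNet

variable {P T : Type} [DecidableEq P] {N : PetriNet P T}

/-- Usable form of the free-choice property. -/
def FC (N : PetriNet P T) : Prop :=
  ∀ t u p, p ∈ N.pre t → p ∈ N.pre u → N.pre t = N.pre u

lemma fire_eq (K : P → ℕ) (t : T) (p : P) :
    N.fire K t p = K p - (if p ∈ N.pre t then 1 else 0) + (if p ∈ N.post t then 1 else 0) := by
  unfold PetriNet.fire
  congr

lemma fire_keep {K : P → ℕ} {t : T} {p : P} (h : p ∉ N.pre t) : K p ≤ N.fire K t p := by
  rw [fire_eq]; simp [h]

lemma fire_keep_post {K : P → ℕ} {t : T} {p : P} (h : p ∉ N.pre t) (h' : p ∈ N.post t) :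
    K p + 1 ≤ N.fire K t p := by
  rw [fire_eq]; simp [h, h']

lemma fire_post {K : P → ℕ} {t : T} {p : P} (h' : p ∈ N.post t) :
    1 ≤ N.fire K t p := by
  rw [fire_eq]; simp [h']

lemma fire_ge {K : P → ℕ} {t : T} {p : P} : K p ≤ N.fire K t p + 1 := by
  rw [fire_eq]; split_ifs <;> omega

lemma enabled_congr {K : P → ℕ} {t u : T} (h : N.pre t = N.pre u) (ht : N.enabled K t) :
    N.enabled K u := by
  intro p hp; exact ht p (h ▸ hp)

lemma fires_append {K L Q : P → ℕ} {σ τ : List T} (h : N.Fires K σ L) (h' : N.Fires L τ Q) :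
    N.Fires K (σ ++ τ) Q := by
  induction h with
  | nil => exact h'
  | cons he _ ih => exact .cons he (ih h')

lemma reach_refl (K : P → ℕ) : N.Reach K K := ⟨[], .nil _⟩

lemma reach_trans {K L Q : P → ℕ} (h : N.Reach K L) (h' : N.Reach L Q) : N.Reach K Q := by
  obtain ⟨σ, h⟩ := h
  obtain ⟨τ, h'⟩ := h'
  exact ⟨_, fires_append h h'⟩

lemma reach_fire {K L : P → ℕ} {t : T} (h : N.Reach K L) (ht : N.enabled L t) :
    N.Reach K (N.fire L t) :=
  reach_trans h ⟨[t], .cons ht (.nil _)⟩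

lemma persist {K L : P → ℕ} {σ : List T} (h : N.Fires K σ L) (p : P)
    (hp : ∀ v ∈ σ, p ∉ N.pre v) : K p ≤ L p := by
  induction h with
  | nil => exact le_rfl
  | cons he _ ih =>
    exact (fire_keep (hp _ (by simp))).trans (ih fun v hv => hp v (by simp [hv]))

lemma produced {K L : P → ℕ} {σ : List T} (h : N.Fires K σ L) (p : P)
    (h0 : K p = 0) (h1 : 1 ≤ L p) : ∃ u ∈ σ, p ∈ N.post u := by
  induction h with
  | nil => omega
  | @cons K t σ L he _ ih =>
    by_cases hp : p ∈ N.post t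
    · exact ⟨t, by simp, hp⟩
    · obtain ⟨u, hu, hup⟩ := ih (by rw [fire_eq]; simp [hp, h0]) h1
      exact ⟨u, by simp [hu], hup⟩

/-- First transition in a firing sequence with a given property. -/
lemma first_occ (Q : T → Prop) {K L : P → ℕ} {σ : List T} (h : N.Fires K σ L) :
    (∀ v ∈ σ, ¬ Q v) ∨ ∃ σ1 v L1, N.Fires K σ1 L1 ∧ N.enabled L1 v ∧ Q v ∧
      (∀ w ∈ σ1, ¬ Q w) ∧ σ1.length < σ.length ∧ (∀ w ∈ σ1, w ∈ σ) ∧ v ∈ σ := by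
  induction h with
  | nil => left; simp
  | @cons K t σ L he _ ih =>
    by_cases hq : Q t
    · right; exact ⟨[], t, K, .nil _, he, hq, by simp, by simp, by simp, by simp⟩
    · rcases ih with ih | ⟨σ1, v, L1, h1, h2, h3, h4, h5, h6, h7⟩
      · left; simpa [hq] using ih
      · right
        refine ⟨t :: σ1, v, L1, .cons he h1, h2, h3, ?_, by simpa using h5, ?_, by simp [h7]⟩
        · simpa [hq] using h4
        · intro w hw
          rcases List.mem_cons.1 hw with rfl | hw
          · simp
          · simp [h6 w hw]

lemma enabled_fire {K : P → ℕ} {t v : T} (hd : ∀ p, p ∈ N.pre t → p ∉ N.pre v)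
    (hv : N.enabled K v) : N.enabled (N.fire K t) v := by
  intro p hp
  exact (hv p hp).trans (fire_keep fun h => hd p h hp)

lemma fire_comm {K : P → ℕ} {t u : T} (hd : ∀ p, p ∈ N.pre t → p ∉ N.pre u)
    (ht : N.enabled K t) (hu : N.enabled K u) :
    N.fire (N.fire K t) u = N.fire (N.fire K u) t := by
  funext p
  have h1 := hd p
  have h2 := ht p
  have h3 := hu p
  simp only [fire_eq]
  by_cases a : p ∈ N.pre t <;> by_cases b : p ∈ N.pre u <;> simp_all <;> omega

/-- Expediting. -/
lemma expedite (hfc : FC N) {L L' : P → ℕ} {σ : List T} (h : N.Fires L σ L') (v : T)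
    (hv : v ∈ σ) (he : N.enabled L v) :
    ∃ u σ', N.pre u = N.pre v ∧ N.enabled L u ∧ N.Fires (N.fire L u) σ' L' ∧
      σ'.length < σ.length := by
  induction h with
  | nil => simp at hv
  | @cons L t σ L' ht hf ih =>
    by_cases hp : N.pre t = N.pre v
    · exact ⟨t, σ, hp, ht, hf, by simp⟩
    · have hv' : v ∈ σ := by
        rcases List.mem_cons.1 hv with rfl | hv
        · exact absurd rfl hp
        · exact hv
      have hd : ∀ p, p ∈ N.pre t → p ∉ N.pre v := fun p h1 h2 => hp (hfc _ _ p h1 h2)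
      obtain ⟨u, σ', h1, h2, h3, h4⟩ := ih hv' (enabled_fire hd he)
      have hu : N.enabled L u := enabled_congr h1.symm he
      have hd' : ∀ p, p ∈ N.pre t → p ∉ N.pre u := by rw [h1]; exact hd
      refine ⟨u, t :: σ', h1, hu, ?_, by simpa using h4⟩
      refine .cons (enabled_fire (fun p a b => hd' p b a) ht) ?_
      rw [← fire_comm hd' ht hu]; exact h3

/-- Setting: `S` is the place set of the home cluster. -/
structure Setting (N : PetriNet P T) (M : P → ℕ) (S : Set P) (H : P → ℕ) : Prop where
  fc : FC N
  prene : ∀ t, (N.pre t).Nonempty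
  postne : ∀ t, (N.post t).Nonempty
  hS : ∀ t p, p ∈ N.pre t → p ∈ S → ∀ q, q ∈ N.pre t ↔ q ∈ S
  H1 : ∀ p ∈ S, H p = 1
  H0 : ∀ p, p ∉ S → H p = 0
  home : ∀ K, N.Reach M K → N.Reach K H

variable {M H : P → ℕ} {S : Set P}

lemma Setting.HS (s : Setting N M S H) {p : P} (h : 1 ≤ H p) : p ∈ S := by
  by_contra hp
  have := s.H0 p hp
  omega

lemma Setting.Hle (s : Setting N M S H) (p : P) : H p ≤ 1 := by
  by_cases hp : p ∈ S
  · rw [s.H1 p hp]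
  · rw [s.H0 p hp]; omega

lemma Setting.cover (s : Setting N M S H) {K : P → ℕ} {t : T} (ht : N.enabled K t) {p : P}
    (hp : p ∈ N.pre t) (hpS : p ∈ S) (q : P) : H q ≤ K q := by
  by_cases hq : q ∈ S
  · rw [s.H1 q hq]; exact ht q ((s.hS t p hp hpS q).2 hq)
  · rw [s.H0 q hq]; omega

lemma Setting.Hen (s : Setting N M S H) {t : T} {p : P}
    (hp : p ∈ N.pre t) (hpS : p ∈ S) : N.enabled H t := by
  intro q hq
  rw [s.H1 q ((s.hS t p hp hpS q).1 hq)]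

lemma grow (s : Setting N M S H) {L L' : P → ℕ} {σ : List T} (h : N.Fires L σ L')
    (hσ : ∀ v ∈ σ, ∀ p ∈ N.pre v, p ∉ S) (hL : ∀ p, H p ≤ L p) (hq : ∃ q, H q < L q) :
    ∃ q, H q < L' q := by
  induction h with
  | nil => exact hq
  | @cons L t σ L' ht hf ih =>
    have hk : ∀ p, H p ≤ N.fire L t p := by
      intro p
      by_cases hp : p ∈ S
      · exact (hL p).trans (fire_keep fun h => hσ t (by simp) p h hp)
      · rw [s.H0 p hp]; omega
    refine ih (fun v hv => hσ v (by simp [hv])) hk ?_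
    obtain ⟨q, hq⟩ := s.postne t
    refine ⟨q, ?_⟩
    by_cases hp : q ∈ S
    · have := fire_keep_post (K := L) (fun h => hσ t (by simp) q h hp) hq
      have := hL q
      omega
    · rw [s.H0 q hp]; exact fire_post hq

lemma noX (s : Setting N M S H) (n : ℕ) : ∀ (σ : List T) (K X : P → ℕ), σ.length = n →
    N.Reach M K → N.Fires (fun p => K p + X p) σ H → ∀ p, X p = 0 := by
  induction n using Nat.strong_induction_on with
  | _ n ih =>
  intro σ K X hn hK hf
  by_cases hv : ∃ v ∈ σ, N.enabled K v
  · obtain ⟨v, hv, hev⟩ := hv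
    obtain ⟨u, σ', h1, h2, h3, h4⟩ :=
      expedite s.fc hf v hv (fun p hp => (hev p hp).trans (Nat.le_add_right _ _))
    have hu := enabled_congr h1.symm hev
    refine ih _ (hn ▸ h4) σ' (N.fire K u) X rfl (reach_fire hK hu) ?_
    have : (fun p => N.fire K u p + X p) = N.fire (fun p => K p + X p) u := by
      funext p
      have h5 := hu p
      simp only [fire_eq]
      by_cases a : p ∈ N.pre u
      · have h6 := h5 a
        simp only [a, if_true]
        omega
      · simp only [a, if_false]
        omega
    rw [this]; exact h3
  · push Not at hv
    have hKH : ∀ p, H p ≤ K p := by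
      by_cases hd : ∃ t, N.enabled K t
      · obtain ⟨t, ht⟩ := hd
        obtain ⟨p, hp⟩ := s.prene t
        have h1 := persist hf p (fun v hv' hpv => hv v hv' (enabled_congr (s.fc _ _ p hp hpv) ht))
        have h2 := ht p hp
        exact s.cover ht hp (s.HS (by omega))
      · push Not at hd
        obtain ⟨τ, hτ⟩ := s.home K hK
        cases hτ with
        | nil => exact fun p => le_rfl
        | cons he _ => exact absurd he (hd _)
    by_contra hX
    push Not at hX
    obtain ⟨q, hq⟩ := hX
    obtain ⟨r, hr⟩ := grow s hf (by
      intro v hv' p hp hpS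
      refine hv v hv' fun q hq => ?_
      have := hKH q
      rw [s.H1 q ((s.hS v p hp hpS q).1 hq)] at this
      exact this) (fun p => (hKH p).trans (Nat.le_add_right _ _))
      ⟨q, by have := hKH q; omega⟩
    omega

lemma eqH (s : Setting N M S H) {K : P → ℕ} (hK : N.Reach M K) (h : ∀ p, H p ≤ K p) :
    K = H := by
  obtain ⟨σ, hσ⟩ := s.home K hK
  have := noX s _ σ H (fun p => K p - H p) rfl (s.home M (reach_refl M)) (by
    have e : (fun p => H p + (K p - H p)) = K := by
      funext p; have := h p; omega
    rw [e]; exact hσ)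
  funext p
  have h1 := this p
  have h2 := h p
  omega

/-- A disentangled path of `n + 1` places, indexed by distance from the home cluster. -/
structure DP (N : PetriNet P T) (S : Set P) (f : ℕ → P) (n : ℕ) : Prop where
  zero : f 0 ∈ S
  step : ∀ i < n, ∃ t, f (i + 1) ∈ N.pre t ∧ f i ∈ N.post t
  dis : ∀ i j, i < j → j ≤ n → ∀ t, f j ∈ N.pre t → f i ∉ N.pre t

lemma DP.notS (s : Setting N M S H) {f : ℕ → P} {n : ℕ} (d : DP N S f n) {j : ℕ} (h0 : 0 < j)
    (hj : j ≤ n) : f j ∉ S := by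
  intro h
  obtain ⟨t, ht, _⟩ := d.step (j - 1) (by omega)
  rw [Nat.sub_add_cancel h0] at ht
  exact d.dis 0 j h0 hj t ht ((s.hS t _ ht h _).2 d.zero)

lemma DP.extend {f : ℕ → P} {n : ℕ} (d : DP N S f n) {t : T} {p : P} (hp : p ∈ N.pre t)
    (hfc : FC N)
    (hq : f n ∈ N.post t) (hno : ∀ j ≤ n, f j ∉ N.pre t) :
    ∃ f', DP N S f' (n + 1) ∧ f' (n + 1) = p ∧ ∀ i ≤ n, f' i = f i := by
  have e : ∀ i ≤ n, (fun i => if i ≤ n then f i else p) i = f i := fun i hi => by simp [hi]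
  have e' : (fun i => if i ≤ n then f i else p) (n + 1) = p := by simp
  generalize (fun i => if i ≤ n then f i else p) = g at e e'
  refine ⟨g, ⟨?_, ?_, ?_⟩, e', e⟩
  · rw [e 0 (by omega)]; exact d.zero
  · intro i hi
    rcases Nat.lt_succ_iff_lt_or_eq.1 hi with h | h
    · rw [e _ h, e i h.le]; exact d.step i h
    · subst h
      rw [e', e i le_rfl]; exact ⟨t, hp, hq⟩
  · intro i j hij hj v hv
    rcases Nat.lt_or_ge n j with h | h
    · have : j = n + 1 := by omega
      subst this
      rw [e'] at hv
      rw [e i (by omega), hfc v t p hv hp]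
      exact hno i (by omega)
    · rw [e j h] at hv
      rw [e i (by omega)]
      exact d.dis i j hij h v hv

lemma DP.swap (s : Setting N M S H) {f : ℕ → P} {n j : ℕ} (d : DP N S f n) (hj : j ≤ n) {t : T}
    {p : P} (hp : p ∈ N.pre t) (hq : f j ∈ N.pre t) :
    ∃ f', DP N S f' j ∧ f' j = p ∧ ∀ i < j, f' i = f i := by
  have e : ∀ i < j, (fun i => if i < j then f i else p) i = f i := fun i hi => by simp [hi]
  have e' : (fun i => if i < j then f i else p) j = p := by simp
  generalize (fun i => if i < j then f i else p) = g at e e'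
  refine ⟨g, ⟨?_, ?_, ?_⟩, e', e⟩
  · rcases Nat.eq_zero_or_pos j with h | h
    · subst h
      rw [e']; exact (s.hS t _ hq d.zero p).1 hp
    · rw [e 0 h]; exact d.zero
  · intro i hi
    obtain ⟨u, hu, hu'⟩ := d.step i (by omega)
    rw [e i hi]
    refine ⟨u, ?_, hu'⟩
    rcases Nat.lt_or_ge (i + 1) j with h | h
    · rw [e _ h]; exact hu
    · have : j = i + 1 := by omega
      subst this
      rw [e', s.fc u t _ hu hq]; exact hp
  · intro i k hik hk v hv
    rw [e i (by omega)]
    rcases Nat.lt_or_ge k j with h | h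
    · rw [e k h] at hv
      exact d.dis i k hik (by omega) v hv
    · have : k = j := by omega
      subst this
      rw [e'] at hv
      refine d.dis i k hik hj v ?_
      rw [s.fc v t p hv hp]; exact hq

lemma DP.exists (s : Setting N M S H) {c : P} (hc : c ∈ S) {x : P ⊕ T}
    (h : Relation.ReflTransGen N.edge x (Sum.inl c)) :
    (∀ p, x = Sum.inl p → ∃ f n, DP N S f n ∧ f n = p) ∧
    (∀ t, x = Sum.inr t → ∃ f n, DP N S f n ∧ f n ∈ N.post t) := by
  induction h using Relation.ReflTransGen.head_induction_on with
  | refl =>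
    refine ⟨?_, by simp⟩
    intro p hp
    cases hp
    exact ⟨fun _ => c, 0, ⟨hc, by simp, by intros; omega⟩, rfl⟩
  | @head a b hab _ ih =>
    rcases a with p | t <;> rcases b with q | u <;> simp only [PetriNet.edge] at hab
    · refine ⟨?_, by simp⟩
      rintro _ ⟨⟩
      obtain ⟨f, n, d, hn⟩ := ih.2 u rfl
      by_cases hno : ∀ j ≤ n, f j ∉ N.pre u
      · obtain ⟨g, d', hg, _⟩ := d.extend hab s.fc hn hno
        exact ⟨g, _, d', hg⟩
      · push Not at hno
        obtain ⟨j, hj, hj'⟩ := hno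
        obtain ⟨g, d', hg, _⟩ := d.swap s hj hab hj'
        exact ⟨g, _, d', hg⟩
    · refine ⟨by simp, ?_⟩
      rintro _ ⟨⟩
      obtain ⟨f, n, d, hn⟩ := ih.1 q rfl
      exact ⟨f, n, d, hn ▸ hab⟩

/-- A reachable marking has at most one token on a disentangled path. -/
lemma two_tokens (s : Setting N M S H) {f : ℕ → P} {n : ℕ} (d : DP N S f n) (m : ℕ) :
    ∀ (i j : ℕ) (K : P → ℕ), i + j = m → N.Reach M K → i ≤ j → j ≤ n →
      1 ≤ K (f i) → 1 ≤ K (f j) → (i = j → 2 ≤ K (f i)) → False := by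
  induction m using Nat.strong_induction_on with
  | _ m ihm =>
  intro i j K hm hK hij hj hi1 hj1 h2
  obtain ⟨σ, hσ⟩ := s.home K hK
  induction σ generalizing K with
  | nil =>
    cases hσ
    rcases Nat.lt_or_eq_of_le hij with h | h
    · exact d.notS s (by omega) hj (s.HS hj1)
    · have := h2 h
      have := s.Hle (f i)
      omega
  | cons t σ ih =>
    cases hσ with
    | cons ht hf =>
    by_cases hjt : f j ∈ N.pre t
    · rcases Nat.eq_zero_or_pos j with h0 | h0
      · subst h0
        obtain rfl : i = 0 := by omega
        have := eqH s hK (s.cover ht hjt d.zero)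
        have h3 := h2 rfl
        have h4 := s.Hle (f 0)
        rw [this] at h3
        omega
      · obtain ⟨k, rfl⟩ : ∃ k, j = k + 1 := ⟨j - 1, by omega⟩
        obtain ⟨u, hu1, hu2⟩ := d.step k (by omega)
        have hu := enabled_congr (s.fc _ _ _ hjt hu1) ht
        have hku := d.dis k (k + 1) (by omega) hj u hu1
        rcases Nat.lt_or_eq_of_le hij with h | h
        · have hiu := d.dis i (k + 1) (by omega) hj u hu1
          refine ihm (i + k) (by omega) i k (N.fire K u) rfl (reach_fire hK hu) (by omega)
            (by omega) (hi1.trans (fire_keep hiu)) (fire_post hu2) ?_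
          rintro rfl
          have := fire_keep_post (K := K) hku hu2
          omega
        · subst h
          refine ihm (k + (k + 1)) (by omega) k (k + 1) (N.fire K u) rfl (reach_fire hK hu)
            (by omega) hj (fire_post hu2) ?_ (by omega)
          have := h2 rfl
          have := fire_ge (N := N) (K := K) (t := u) (p := f (k + 1))
          omega
    · by_cases hit : f i ∈ N.pre t
      · have hlt : i < j := by
          rcases Nat.lt_or_eq_of_le hij with h | h
          · exact h
          · subst h; exact absurd hit hjt
        rcases Nat.eq_zero_or_pos i with h0 | h0
        · subst h0
          have := eqH s hK (s.cover ht hit d.zero)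
          rw [this] at hj1
          exact d.notS s (by omega) hj (s.HS hj1)
        · obtain ⟨k, rfl⟩ : ∃ k, i = k + 1 := ⟨i - 1, by omega⟩
          obtain ⟨u, hu1, hu2⟩ := d.step k (by omega)
          have hpe := s.fc _ _ _ hit hu1
          have hu := enabled_congr hpe ht
          exact ihm (k + j) (by omega) k j (N.fire K u) rfl (reach_fire hK hu) (by omega)
            hj (fire_post hu2) (hj1.trans (fire_keep (hpe ▸ hjt))) (by omega)
      · refine ih (N.fire K t) (reach_fire hK ht) (hi1.trans (fire_keep hit))
          (hj1.trans (fire_keep hjt)) (fun h => (h2 h).trans (fire_keep hit)) hf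

/-- Every enabled cluster of `K1` is marked in `K2`. -/
def Inv (N : PetriNet P T) (K1 K2 : P → ℕ) : Prop :=
  ∀ t, N.enabled K1 t → ∃ p ∈ N.pre t, 1 ≤ K2 p

lemma Inv.fire {K1 K2 : P → ℕ} (hfc : FC N) (hne : ∀ t, (N.pre t).Nonempty)
    (h : Inv N K1 K2) (hs : ∀ p, K1 p ≤ 1) (u : T) :
    Inv N (N.fire K1 u) (N.fire K2 u) := by
  intro t ht
  by_cases hq : ∃ q ∈ N.pre t, q ∈ N.post u
  · obtain ⟨q, h1, h2⟩ := hq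
    exact ⟨q, h1, fire_post h2⟩
  · push Not at hq
    by_cases hp : ∃ p ∈ N.pre t, p ∈ N.pre u
    · obtain ⟨p, h1, h2⟩ := hp
      have h3 := ht p h1
      have h4 := hs p
      rw [fire_eq] at h3
      simp [h2, hq p h1] at h3
      omega
    · push Not at hp
      obtain ⟨p, h1, h2⟩ := h t (fun p h1 => by
        have h3 := ht p h1
        rw [fire_eq] at h3
        simpa [hp p h1, hq p h1] using h3)
      exact ⟨p, h1, h2.trans (fire_keep (hp p h1))⟩

lemma chain (s : Setting N M S H) {K1 K2 : P → ℕ} (hK2 : N.Reach M K2) (hinv : Inv N K1 K2)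
    (k : ℕ) : ∀ (σ : List T) (L : P → ℕ) (f : ℕ → P) (n j : ℕ), σ.length = k → N.Fires K1 σ L →
      DP N S f n → K1 (f n) = 0 → 1 ≤ L (f n) → j ≤ n → 1 ≤ K2 (f j) →
      (∀ v ∈ σ, ∀ i ≤ n, f i ∉ N.pre v) → False := by
  induction k using Nat.strong_induction_on with
  | _ k ih =>
  intro σ L f n j hk hf d h0 h1 hj hj1 hσ
  obtain ⟨u, hu, hup⟩ := produced hf _ h0 h1
  by_cases hen : N.enabled K1 u
  · obtain ⟨p, hp, hp1⟩ := hinv u hen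
    obtain ⟨g, d', hg, hg'⟩ := d.extend hp s.fc hup (hσ u hu)
    exact two_tokens s d' _ j (n + 1) K2 rfl hK2 (by omega) le_rfl (by rw [hg' j hj]; exact hj1)
      (by rw [hg]; exact hp1) (by omega)
  · unfold PetriNet.enabled at hen
    push Not at hen
    obtain ⟨p, hp, hp0⟩ := hen
    obtain ⟨g, d', hg, hg'⟩ := d.extend hp s.fc hup (hσ u hu)
    rcases first_occ (fun v => N.pre v = N.pre u) hf with h | ⟨σ1, v, L1, a1, a2, a3, a4, a5, a6, _⟩
    · exact h u hu rfl
    · refine ih _ (hk ▸ a5) σ1 L1 g (n + 1) j rfl a1 d' (by rw [hg]; omega)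
        (by rw [hg]; exact a2 p (a3 ▸ hp)) (by omega) (by rw [hg' j hj]; exact hj1) ?_
      intro w hw i hi hiw
      rcases Nat.lt_or_ge n i with h | h
      · obtain rfl : i = n + 1 := by omega
        rw [hg] at hiw
        exact a4 w hw (s.fc _ _ p hiw hp)
      · rw [hg' i h] at hiw
        exact hσ w (a6 w hw) i h hiw

lemma lucentAux (s : Setting N M S H) (hdp : ∀ p, ∃ f n, DP N S f n ∧ f n = p)
    (hsafe : ∀ K, N.Reach M K → ∀ p, K p ≤ 1)
    (k : ℕ) : ∀ (σ : List T) (K1 K2 : P → ℕ), σ.length = k → N.Reach M K1 → N.Reach M K2 →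
      Inv N K1 K2 → Inv N K2 K1 → N.Fires K1 σ H → K1 = K2 := by
  induction k using Nat.strong_induction_on with
  | _ k ih =>
  intro σ K1 K2 hk hK1 hK2 i12 i21 hf
  by_cases hv : ∃ v ∈ σ, N.enabled K1 v ∧ N.enabled K2 v
  · obtain ⟨v, hv, h1, h2⟩ := hv
    obtain ⟨u, σ', a1, a2, a3, a4⟩ := expedite s.fc hf v hv h1
    have hu2 := enabled_congr a1.symm h2
    have := ih _ (hk ▸ a4) σ' _ _ rfl (reach_fire hK1 a2) (reach_fire hK2 hu2)
      (i12.fire s.fc s.prene (hsafe _ hK1) u) (i21.fire s.fc s.prene (hsafe _ hK2) u) a3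
    funext p
    have e := congrFun this p
    have b1 := a2 p
    have b2 := hu2 p
    simp only [fire_eq] at e
    by_cases a : p ∈ N.pre u
    · have c1 := b1 a
      have c2 := b2 a
      simp only [a, if_true] at e
      omega
    · simp only [a, if_false] at e
      omega
  push Not at hv
  by_cases hc : ∃ t, N.enabled K1 t ∧ N.enabled K2 t
  · obtain ⟨t, h1, h2⟩ := hc
    obtain ⟨p, hp⟩ := s.prene t
    have h3 := persist hf p (fun v hv' hpv => hv v hv'
      (enabled_congr (s.fc _ _ p hp hpv) h1) (enabled_congr (s.fc _ _ p hp hpv) h2))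
    have h4 := h1 p hp
    have hpS : p ∈ S := s.HS (by omega)
    rw [eqH s hK1 (s.cover h1 hp hpS), eqH s hK2 (s.cover h2 hp hpS)]
  push Not at hc
  have key : ∀ K K', N.Reach M K' → K = H → Inv N K' K →
      (∀ t, N.enabled K t → ¬ N.enabled K' t) → K' = H := by
    rintro K K' hK' rfl hi hn
    obtain ⟨τ, hτ⟩ := s.home K' hK'
    cases hτ with
    | nil => rfl
    | cons he _ =>
      obtain ⟨p, hp, hp1⟩ := hi _ he
      exact absurd he (hn _ (s.Hen hp (s.HS hp1)))
  by_cases e1 : K1 = H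
  · rw [key K1 K2 hK2 e1 i21 hc, e1]
  by_cases e2 : K2 = H
  · rw [key K2 K1 hK1 e2 i12 (fun t a b => hc t b a), e2]
  exfalso
  obtain ⟨τ, hτ⟩ := s.home K2 hK2
  cases hτ with
  | nil => exact e2 rfl
  | @cons _ t _ _ ht _ =>
  have hnS : ∀ p ∈ N.pre t, p ∉ S := fun p hp hpS => e2 (eqH s hK2 (s.cover ht hp hpS))
  obtain ⟨p2, hp2, hp21⟩ := i21 t ht
  have hne : ¬ N.enabled K1 t := fun h => hc t h ht
  unfold PetriNet.enabled at hne
  push Not at hne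
  obtain ⟨m, hm, hm0⟩ := hne
  obtain ⟨f, n, d, rfl⟩ := hdp m
  obtain ⟨g, d', hg, hg'⟩ := d.swap s le_rfl hp2 hm
  rcases first_occ (fun v => p2 ∈ N.pre v) hf with h | ⟨σ1, v, L1, a1, a2, a3, a4, a5, a6, _⟩
  · have := persist hf p2 h
    exact hnS p2 hp2 (s.HS (by omega))
  · have hpe := s.fc _ _ p2 a3 hp2
    refine chain s hK2 i12 _ σ1 L1 f n n rfl a1 d (by omega) (a2 _ (hpe ▸ hm)) le_rfl
      (ht _ hm) ?_
    rcases first_occ (fun v => ∃ i ≤ n, f i ∈ N.pre v) a1 with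
      h | ⟨σ2, w, L2, b1, b2, b3, b4, b5, b6, b7⟩
    · intro v hv i hi hiv
      exact h v hv ⟨i, hi, hiv⟩
    · exfalso
      obtain ⟨i, hi, hiw⟩ := b3
      have hp2' := persist b1 p2 (fun x hx => a4 x (b6 x hx))
      rcases Nat.lt_or_eq_of_le hi with h | h
      · exact two_tokens s d' _ i n L2 rfl (reach_trans hK1 ⟨_, b1⟩) hi le_rfl
          (by rw [hg' i h]; exact b2 _ hiw) (by rw [hg]; omega) (by omega)
      · subst h
        have hw := s.fc _ _ _ hiw hm
        exact a4 w b7 (hw ▸ hp2)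

lemma liveAux (s : Setting N M S H) {c : P} (hc : c ∈ S) {y : P ⊕ T}
    (h : Relation.ReflTransGen N.edge (Sum.inl c) y) :
    (∀ p, y = Sum.inl p → ∃ K, N.Reach H K ∧ 1 ≤ K p) ∧
    (∀ t, y = Sum.inr t → ∃ K, N.Reach H K ∧ N.enabled K t) := by
  have hMH : N.Reach M H := s.home M (reach_refl M)
  induction h with
  | refl =>
    refine ⟨?_, by simp⟩
    rintro _ ⟨⟩
    exact ⟨H, reach_refl H, (s.H1 c hc).ge⟩
  | @tail a b _ hab ih =>
    rcases a with p | t <;> rcases b with q | u <;> simp only [PetriNet.edge] at hab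
    · refine ⟨by simp, ?_⟩
      rintro _ ⟨⟩
      obtain ⟨K, hK, hKp⟩ := ih.1 p rfl
      obtain ⟨σ, hσ⟩ := s.home K (reach_trans hMH hK)
      rcases first_occ (fun v => p ∈ N.pre v) hσ with h | ⟨σ1, v, L1, a1, a2, a3, -⟩
      · have := persist hσ p h
        exact ⟨H, reach_refl H, s.Hen hab (s.HS (by omega))⟩
      · exact ⟨L1, reach_trans hK ⟨_, a1⟩, enabled_congr (s.fc _ _ p a3 hab) a2⟩
    · refine ⟨?_, by simp⟩
      rintro _ ⟨⟩
      obtain ⟨K, hK, hKt⟩ := ih.2 t rfl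
      exact ⟨_, reach_fire hK hKt, fire_post hab⟩

lemma clusterAux (hfc : FC N) {x y : P ⊕ T} (h : N.InCluster x y) (t : T)
    (hne : ∀ t, (N.pre t).Nonempty) :
    (Sum.elim (fun q => q ∈ N.pre t) (fun u => N.pre u = N.pre t) y ↔
      Sum.elim (fun q => q ∈ N.pre t) (fun u => N.pre u = N.pre t) x) := by
  induction h with
  | refl => rfl
  | @toTrans p u _ hp ih =>
    rw [← ih]
    simp only [Sum.elim_inr, Sum.elim_inl]
    exact ⟨fun h => h ▸ hp, fun h => hfc _ _ p hp h⟩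
  | @toPlace u p _ hp ih =>
    rw [← ih]
    simp only [Sum.elim_inr, Sum.elim_inl]
    exact ⟨fun h => hfc _ _ p hp h, fun h => h ▸ hp⟩

end HomeProof

open HomeProof

/-- A strongly-connected marked free-choice net having a home
cluster is live, safe, and lucent. -/
theorem strongly_connected_home_cluster {P T : Type} [DecidableEq P]
    (N : PetriNet P T) (M : P → ℕ) (C : Set (P ⊕ T))
    (hsc : ∀ x y : P ⊕ T, Relation.ReflTransGen N.edge x y)
    (hfc : N.FreeChoice) (hc : N.HomeCluster M C) :
    N.Live M ∧ N.Safe M ∧ N.Lucent M := by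
  obtain ⟨⟨x, rfl⟩, hhome⟩ := hc
  rcases isEmpty_or_nonempty P with hP | ⟨⟨p0⟩⟩
  · refine ⟨?_, ?_, ?_⟩
    · intro M' _ t
      exact ⟨M', reach_refl _, fun p => isEmptyElim p⟩
    · intro M' _ p
      exact isEmptyElim p
    · intro M1 M2 _ _ _
      exact Subsingleton.elim _ _
  have hfc' : FC N := by
    intro t u p h1 h2
    rcases hfc t u with h | h
    · exact h
    · have : p ∈ N.pre t ∩ N.pre u := Finset.mem_inter.2 ⟨h1, h2⟩
      rw [h] at this
      simp at this
  have hpost : ∀ t, (N.post t).Nonempty := by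
    intro t
    rcases (hsc (Sum.inr t) (Sum.inl p0)).cases_head with h | ⟨c, h, _⟩
    · cases h
    · rcases c with q | u <;> simp only [PetriNet.edge] at h
      exact ⟨q, h⟩
  have hpre : ∀ t, (N.pre t).Nonempty := by
    intro t
    rcases (hsc (Sum.inl p0) (Sum.inr t)).cases_tail with h | ⟨c, _, h⟩
    · cases h
    · rcases c with q | u <;> simp only [PetriNet.edge] at h
      exact ⟨q, h⟩
  have s : Setting N M {p | Sum.inl p ∈ N.cluster x} (PetriNet.clusterMrk (N.cluster x)) := by
    refine ⟨hfc', hpre, hpost, ?_, ?_, ?_, hhome⟩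
    · intro t p hp hpS q
      constructor
      · intro hq
        exact .toPlace (.toTrans hpS hp) hq
      · intro hq
        have h1 := clusterAux hfc' hq t hpre
        have h2 := clusterAux hfc' hpS t hpre
        exact h1.2 (h2.1 hp)
    · intro p hp
      simp only [Set.mem_setOf_eq] at hp
      simp [PetriNet.clusterMrk, hp]
    · intro p hp
      simp only [Set.mem_setOf_eq] at hp
      simp [PetriNet.clusterMrk, hp]
  obtain ⟨c, hc⟩ : ∃ c, Sum.inl c ∈ N.cluster x := by
    rcases x with p | t
    · exact ⟨p, .refl _⟩
    · obtain ⟨p, hp⟩ := hpre t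
      exact ⟨p, .toPlace (.refl _) hp⟩
  have hdp : ∀ p, ∃ f n, DP N {p | Sum.inl p ∈ N.cluster x} f n ∧ f n = p :=
    fun p => (DP.exists s hc (hsc (Sum.inl p) (Sum.inl c))).1 p rfl
  have hsafe : N.Safe M := by
    intro K hK p
    by_contra hlt
    obtain ⟨f, n, d, rfl⟩ := hdp p
    exact two_tokens s d _ n n K rfl hK le_rfl le_rfl (by omega) (by omega) (by omega)
  refine ⟨?_, hsafe, ?_⟩
  · intro M' hM' t
    obtain ⟨K, hK, hKt⟩ := (liveAux s hc (hsc (Sum.inl c) (Sum.inr t))).2 t rfl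
    exact ⟨K, reach_trans (hhome M' hM') hK, hKt⟩
  · intro M1 M2 h1 h2 he
    obtain ⟨σ, hσ⟩ := hhome M1 h1
    have key : ∀ K1 K2 : P → ℕ, N.en K1 = N.en K2 → Inv N K1 K2 := by
      intro K1 K2 h t ht
      have h' : t ∈ N.en K2 := h ▸ (show t ∈ N.en K1 from ht)
      obtain ⟨p, hp⟩ := hpre t
      exact ⟨p, hp, h' p hp⟩
    exact lucentAux s hdp hsafe _ σ M1 M2 rfl h1 h2 (key _ _ he) (key _ _ he.symm) hσ
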